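/- Let μ ∈ ℝᵏ and let Σ ∈ ℝ^{k×k} be a symmetric positive-definite matrix, and let p(x) = ((2π)^k det Σ)^{−1/2} exp(−½ (x − μ)ᵀ Σ⁻¹ (x − μ)) be the corresponding Gaussian density. Then ∫_{ℝᵏ} √(p(x)) · √(p(x)) dx = 1. Consequently, if A ∈ ℝ^{n×n}, P is a permutation matrix, Σ^A is positive definite, and ‖x_A⁽ᵗ⁾‖₁ ≠ 0 for all 0 ≤ t < k, then the power kernel satisfies K(A, PAPᵀ) = ∫_{ℝᵏ} √(Ψ^A(x)) √(Ψ^{PAPᵀ}(x)) dx = 1. -/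

import Mathlib

open Matrix MeasureTheory Real BigOperators

/-- The permutation matrix of `σ`: `(P v) (σ i) = v i`. -/
noncomputable def permMatrix {n : ℕ} (σ : Equiv.Perm (Fin n)) : Matrix (Fin n) (Fin n) ℝ :=
  Matrix.of fun i j => if i = σ j then 1 else 0

/-- ℓ1 norm of a vector. -/
noncomputable def l1norm {n : ℕ} (v : Fin n → ℝ) : ℝ := ∑ i, |v i|

/-- Power iteration started at the all-ones vector. -/
noncomputable def powerIter {n : ℕ} (A : Matrix (Fin n) (Fin n) ℝ) : ℕ → (Fin n → ℝ)
  | 0 => fun _ => 1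
  | t + 1 => A.mulVec ((l1norm (powerIter A t))⁻¹ • powerIter A t)

/-- Power summary `S^A ∈ ℝ^{n×k}`, whose `t`-th column is `x_A^{(t+1)}`. -/
noncomputable def powSummary {n : ℕ} (k : ℕ) (A : Matrix (Fin n) (Fin n) ℝ) :
    Matrix (Fin n) (Fin k) ℝ :=
  Matrix.of fun i t => powerIter A (t + 1) i

/-- Mean vector of the rows of the power summary. -/
noncomputable def meanVec {n : ℕ} (k : ℕ) (A : Matrix (Fin n) (Fin n) ℝ) : Fin k → ℝ :=
  (n : ℝ)⁻¹ • ∑ i, powSummary k A i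

/-- Sample covariance matrix of the rows of the power summary. -/
noncomputable def covMat {n : ℕ} (k : ℕ) (A : Matrix (Fin n) (Fin n) ℝ) :
    Matrix (Fin k) (Fin k) ℝ :=
  (n : ℝ)⁻¹ • ∑ i, vecMulVec (powSummary k A i - meanVec k A) (powSummary k A i - meanVec k A)

/-- Gaussian functional representation `Ψ^A`. -/
noncomputable def psi {n : ℕ} (k : ℕ) (A : Matrix (Fin n) (Fin n) ℝ) (x : Fin k → ℝ) : ℝ :=
  (Real.sqrt ((2 * Real.pi) ^ k * (covMat k A).det))⁻¹ *
    Real.exp (-(dotProduct (x - meanVec k A) ((covMat k A)⁻¹ *ᵥ (x - meanVec k A))) / 2)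


/-- The Gaussian density with mean `μ` and covariance `S`. -/
noncomputable def gaussDensity {k : ℕ} (μ : Fin k → ℝ) (S : Matrix (Fin k) (Fin k) ℝ)
    (x : Fin k → ℝ) : ℝ :=
  (Real.sqrt ((2 * Real.pi) ^ k * S.det))⁻¹ *
    Real.exp (-(dotProduct (x - μ) (S⁻¹ *ᵥ (x - μ))) / 2)

lemma integral_exp_neg_half_dotProduct_self (k : ℕ) :
    ∫ x : Fin k → ℝ, Real.exp (-(x ⬝ᵥ x) / 2) = Real.sqrt (2 * Real.pi) ^ k := by
  have h (x : Fin k → ℝ) :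
      Real.exp (-(x ⬝ᵥ x) / 2) = ∏ i, Real.exp (-(1 / 2) * x i ^ 2) := by
    rw [← Real.exp_sum]
    congr 1
    rw [← Finset.mul_sum, dotProduct]
    simp only [pow_two]
    ring
  simp_rw [h]
  rw [integral_fintype_prod_volume_eq_pow (fun y : ℝ => Real.exp (-(1 / 2) * y ^ 2)),
    integral_gaussian, Fintype.card_fin]
  congr 2
  ring

lemma integral_comp_mulVec {k : ℕ} {M : Matrix (Fin k) (Fin k) ℝ} (hM : M.det ≠ 0)
    {f : (Fin k → ℝ) → ℝ} (hf : Continuous f) :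
    ∫ x, f (M *ᵥ x) = |M.det⁻¹| * ∫ x, f x := by
  have h := integral_map (μ := volume) (φ := Matrix.toLin' M) (f := f)
    (LinearMap.continuous_on_pi _).aemeasurable hf.aestronglyMeasurable
  rw [Real.map_matrix_volume_pi_eq_smul_volume_pi hM, integral_smul_measure,
    ENNReal.toReal_ofReal (abs_nonneg _)] at h
  simpa using h.symm

lemma integral_gaussDensity {k : ℕ} (μ : Fin k → ℝ) {S : Matrix (Fin k) (Fin k) ℝ}
    (hS : S.PosDef) : ∫ x, gaussDensity μ S x = 1 := by
  obtain ⟨B, hB⟩ : ∃ B : Matrix (Fin k) (Fin k) ℝ, S⁻¹ = Bᵀ * B := by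
    open scoped MatrixOrder Matrix.Norms.L2Operator in
    obtain ⟨B, hB⟩ := CStarAlgebra.nonneg_iff_eq_star_mul_self.mp hS.inv.posSemidef.nonneg
    exact ⟨B, by rw [hB, Matrix.star_eq_conjTranspose, Matrix.conjTranspose_eq_transpose_of_trivial]⟩
  have hdet : S.det⁻¹ = B.det ^ 2 := by
    have := congrArg Matrix.det hB
    rw [Matrix.det_mul, Matrix.det_transpose, Matrix.det_nonsing_inv,
      Ring.inverse_eq_inv'] at this
    rw [this, pow_two]
  have hpos := hS.det_pos
  have hB0 : B.det ≠ 0 := by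
    intro h
    rw [h] at hdet
    simp [hpos.ne'] at hdet
  have hS' : S.det = (|B.det⁻¹|) ^ 2 := by
    rw [sq_abs, inv_pow, ← hdet, inv_inv]
  have hq (x : Fin k → ℝ) : x ⬝ᵥ (S⁻¹ *ᵥ x) = (B *ᵥ x) ⬝ᵥ (B *ᵥ x) := by
    rw [hB, ← Matrix.mulVec_mulVec, Matrix.dotProduct_mulVec, Matrix.vecMul_transpose]
  have hc : Real.sqrt ((2 * Real.pi) ^ k * S.det) = |B.det⁻¹| * Real.sqrt (2 * Real.pi) ^ k := by
    rw [hS', Real.sqrt_mul (by positivity), Real.sqrt_sq (abs_nonneg _), mul_comm]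
    congr 1
    rw [Real.sqrt_eq_iff_eq_sq (by positivity) (by positivity), ← pow_mul, mul_comm k, pow_mul,
      Real.sq_sqrt (by positivity)]
  unfold gaussDensity
  rw [integral_const_mul,
    integral_sub_right_eq_self (fun x => Real.exp (-(x ⬝ᵥ (S⁻¹ *ᵥ x)) / 2)) μ]
  simp_rw [hq]
  rw [integral_comp_mulVec hB0 (f := fun x => Real.exp (-(x ⬝ᵥ x) / 2))
    (by unfold dotProduct; fun_prop), integral_exp_neg_half_dotProduct_self, ← hc]
  exact inv_mul_cancel₀ (Real.sqrt_pos.2 (by positivity)).ne'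

lemma gaussDensity_nonneg {k : ℕ} (μ : Fin k → ℝ) (S : Matrix (Fin k) (Fin k) ℝ)
    (x : Fin k → ℝ) : 0 ≤ gaussDensity μ S x := by
  unfold gaussDensity
  positivity

lemma psi_eq_gaussDensity {n : ℕ} (k : ℕ) (A : Matrix (Fin n) (Fin n) ℝ) :
    psi k A = gaussDensity (meanVec k A) (covMat k A) := rfl

lemma permMatrix_conj {n : ℕ} (σ : Equiv.Perm (Fin n)) (A : Matrix (Fin n) (Fin n) ℝ) :
    permMatrix σ * A * (permMatrix σ)ᵀ = A.submatrix σ.symm σ.symm := by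
  ext i j
  simp [permMatrix, Matrix.mul_apply, ← Equiv.symm_apply_eq]

lemma l1norm_comp_perm {n : ℕ} (σ : Equiv.Perm (Fin n)) (v : Fin n → ℝ) :
    l1norm (v ∘ σ) = l1norm v :=
  Equiv.sum_comp σ fun i => |v i|

lemma powerIter_submatrix {n : ℕ} (σ : Equiv.Perm (Fin n)) (A : Matrix (Fin n) (Fin n) ℝ)
    (t : ℕ) : powerIter (A.submatrix σ σ) t = powerIter A t ∘ σ := by
  induction t with
  | zero => rfl
  | succ t ih =>
    rw [powerIter, ih, l1norm_comp_perm, powerIter, Matrix.submatrix_mulVec_equiv]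
    congr 2
    ext i
    simp

lemma powSummary_submatrix {n : ℕ} (k : ℕ) (σ : Equiv.Perm (Fin n))
    (A : Matrix (Fin n) (Fin n) ℝ) (i : Fin n) :
    powSummary k (A.submatrix σ σ) i = powSummary k A (σ i) := by
  ext t
  simp [powSummary, powerIter_submatrix]

lemma meanVec_submatrix {n : ℕ} (k : ℕ) (σ : Equiv.Perm (Fin n))
    (A : Matrix (Fin n) (Fin n) ℝ) : meanVec k (A.submatrix σ σ) = meanVec k A := by
  simp only [meanVec, powSummary_submatrix]
  rw [Equiv.sum_comp σ (fun i => powSummary k A i)]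

lemma covMat_submatrix {n : ℕ} (k : ℕ) (σ : Equiv.Perm (Fin n))
    (A : Matrix (Fin n) (Fin n) ℝ) : covMat k (A.submatrix σ σ) = covMat k A := by
  simp only [covMat, powSummary_submatrix, meanVec_submatrix]
  rw [Equiv.sum_comp σ (fun i =>
    vecMulVec (powSummary k A i - meanVec k A) (powSummary k A i - meanVec k A))]

lemma integral_sqrt_gaussDensity_mul_self {k : ℕ} (μ : Fin k → ℝ)
    {S : Matrix (Fin k) (Fin k) ℝ} (hS : S.PosDef) :
    ∫ x, Real.sqrt (gaussDensity μ S x) * Real.sqrt (gaussDensity μ S x) = 1 := by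
  simp_rw [Real.mul_self_sqrt (gaussDensity_nonneg μ S _)]
  exact integral_gaussDensity μ hS

/-- The Bhattacharyya coefficient of a Gaussian density with itself is 1; consequently the
power kernel between a graph and any reordering of its vertices equals 1. -/
theorem bhattacharyya_self_gaussian_and_power_kernel_isomorphic {k n : ℕ}
    (μ : Fin k → ℝ) (S : Matrix (Fin k) (Fin k) ℝ) (hS : S.PosDef)
    (A : Matrix (Fin n) (Fin n) ℝ) (σ : Equiv.Perm (Fin n))
    (hcov : (covMat k A).PosDef)
    (hl1 : ∀ t < k, l1norm (powerIter A t) ≠ 0) :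
    (∫ x : Fin k → ℝ, Real.sqrt (gaussDensity μ S x) * Real.sqrt (gaussDensity μ S x)) = 1 ∧
      (∫ x : Fin k → ℝ, Real.sqrt (psi k A x) *
          Real.sqrt (psi k (permMatrix σ * A * (permMatrix σ)ᵀ) x)) = 1 := by
  refine ⟨integral_sqrt_gaussDensity_mul_self μ hS, ?_⟩
  simp only [psi_eq_gaussDensity, permMatrix_conj, meanVec_submatrix, covMat_submatrix]
  exact integral_sqrt_gaussDensity_mul_self _ hcov
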